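/- Let R be a commutative ring of prime characteristic p and R → S an étale ring homomorphism. Then the relative Frobenius map S ⊗_{R, F} R → S (induced by the absolute Frobenii of R and S) is an isomorphism; equivalently, the natural map S ⊗_R F_* R → F_* S is an isomorphism of S-modules. -/

import Mathlib

universe u

open TensorProduct

/-- The Frobenius pushforward `F_* R`: the carrier `R` regarded as an
`R`-module via the Frobenius `x ↦ x ^ p`, so `r • m = r ^ p * m`. -/
def FrobPush (p : ℕ) (R : Type*) : Type _ := R

instance (p : ℕ) (R : Type*) [CommRing R] : AddCommGroup (FrobPush p R) :=
  inferInstanceAs (AddCommGroup R)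

instance (p : ℕ) (R : Type*) [CommRing R] [Fact p.Prime] [CharP R p] :
    Module R (FrobPush p R) :=
  Module.compHom R (frobenius R p)

lemma frob_factor_bijective {T S : Type*} [CommRing T] [CommRing S] [Algebra T S]
    [Algebra.Etale T S] (p : ℕ) [hp : Fact p.Prime] [CharP S p] (g : S →+* T)
    (h1 : ∀ s, algebraMap T S (g s) = s ^ p) (h2 : ∀ t, g (algebraMap T S t) = t ^ p) :
    Function.Bijective (algebraMap T S) := by
  have hp0 : p ≠ 0 := hp.out.ne_zero
  have hfin : Module.Finite T S := by
    have : Algebra.IsIntegral T S := ⟨fun s => by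
      refine IsIntegral.of_pow hp.out.pos (x := s) ?_
      rw [← h1]
      exact isIntegral_algebraMap⟩
    exact Algebra.IsIntegral.finite
  constructor
  · have : Module.FaithfullyFlat T S := by
      refine Module.FaithfullyFlat.of_comap_surjective fun q => ?_
      refine ⟨PrimeSpectrum.comap g q, ?_⟩
      ext t
      simp only [PrimeSpectrum.comap_asIdeal, Ideal.mem_comap, h2]
      exact q.2.pow_mem_iff_mem p hp.out.pos
    exact FaithfulSMul.algebraMap_injective T S
  · rw [← Algebra.isEpi_iff_surjective_algebraMap_of_finite,
      Algebra.isEpi_iff_forall_one_tmul_eq]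
    obtain ⟨t, ht, ht1⟩ :=
      (Algebra.FormallyUnramified.iff_exists_tensorProduct (R := T) (S := S)).1 inferInstance
    have hle : KaehlerDifferential.ideal T S ≤ nilradical (S ⊗[T] S) := by
      rw [← KaehlerDifferential.span_range_eq_ideal, Ideal.span_le]
      rintro _ ⟨s, rfl⟩
      refine ⟨p, ?_⟩
      have hpz : (p : S ⊗[T] S) = 0 := by
        have := congrArg (algebraMap S (S ⊗[T] S)) (CharP.cast_eq_zero S p)
        rwa [map_natCast, map_zero] at this
      nontriviality (S ⊗[T] S)
      have : CharP (S ⊗[T] S) p := (CharP.charP_iff_prime_eq_zero hp.out).2 hpz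
      change (1 ⊗ₜ[T] s - s ⊗ₜ[T] 1) ^ p = 0
      rw [sub_pow_char, Algebra.TensorProduct.tmul_pow, Algebra.TensorProduct.tmul_pow,
        one_pow, ← h1, Algebra.algebraMap_eq_smul_one, TensorProduct.tmul_smul,
        TensorProduct.smul_tmul', sub_self]
    have hu : IsUnit t := by
      have : 1 - t ∈ KaehlerDifferential.ideal T S := by
        simp [KaehlerDifferential.ideal, RingHom.mem_ker, ht1]
      have hn : IsNilpotent (1 - t) := hle this
      simpa using hn.isUnit_one_sub
    intro a
    exact sub_eq_zero.1 ((hu.mul_left_eq_zero).1 (ht a))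

/-- Copy of `R`, as an `R`-algebra via Frobenius. -/
def FrobAlg (_p : ℕ) (R : Type*) : Type _ := R

instance frobPushCommRing (p : ℕ) (R : Type*) [CommRing R] : CommRing (FrobAlg p R) :=
  inferInstanceAs (CommRing R)

instance frobPushAlgebra (p : ℕ) (R : Type*) [CommRing R] [Fact p.Prime] [CharP R p] :
    Algebra R (FrobAlg p R) where
  smul r m := (frobenius R p r * (show R from m) : R)
  algebraMap := frobenius R p
  commutes' _ _ := mul_comm (G := R) _ _
  smul_def' _ _ := rfl

theorem relFrob_core (R S : Type u) [CommRing R] [CommRing S]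
    [Algebra R S] [Algebra.Etale R S] (p : ℕ) [Fact p.Prime] [CharP R p] [CharP S p] :
    ∃ φ : (S ⊗[R] FrobAlg p R) →+ S,
      (∀ (s : S) (r : R),
        φ (s ⊗ₜ[R] (show FrobAlg p R from r)) = algebraMap R S r * s ^ p) ∧
      Function.Bijective φ := by
  let aPQ : Algebra (FrobAlg p R) (FrobAlg p S) := inferInstanceAs (Algebra R S)
  let aRQ : Algebra R (FrobAlg p S) :=
    ((algebraMap (FrobAlg p R) (FrobAlg p S)).comp (algebraMap R (FrobAlg p R))).toAlgebra
  have : IsScalarTower R (FrobAlg p R) (FrobAlg p S) := .of_algebraMap_eq fun _ => rfl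
  have : CharP (FrobAlg p S) p := inferInstanceAs (CharP S p)
  have : CharP (FrobAlg p R) p := inferInstanceAs (CharP R p)
  have : Algebra.Etale (FrobAlg p R) (FrobAlg p S) := inferInstanceAs (Algebra.Etale R S)
  let F : S →ₐ[R] FrobAlg p S :=
    { (frobenius S p : S →+* S) with
      commutes' := fun r => by
        change (algebraMap R S r) ^ p = algebraMap R S (r ^ p)
        rw [map_pow] }
  let Φ : (FrobAlg p R ⊗[R] S) →ₐ[FrobAlg p R] FrobAlg p S :=
    Algebra.TensorProduct.lift (Algebra.ofId _ _) F (fun _ _ => Commute.all _ _)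
  have hΦ : ∀ (r : FrobAlg p R) (s : S), Φ (r ⊗ₜ s) =
      (show FrobAlg p S from (algebraMap R S r * s ^ p : S)) := fun r s => by
    simp only [Φ, Algebra.TensorProduct.lift_tmul]; rfl
  let aT : Algebra (FrobAlg p R ⊗[R] S) (FrobAlg p S) := Φ.toRingHom.toAlgebra
  have : IsScalarTower (FrobAlg p R) (FrobAlg p R ⊗[R] S) (FrobAlg p S) :=
    .of_algebraMap_eq fun r => (Φ.commutes r).symm
  have : Algebra.Etale (FrobAlg p R ⊗[R] S) (FrobAlg p S) :=
    .of_restrictScalars (FrobAlg p R) _ _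
  let g : FrobAlg p S →+* (FrobAlg p R ⊗[R] S) :=
    (Algebra.TensorProduct.includeRight : S →ₐ[R] FrobAlg p R ⊗[R] S).toRingHom
  have key : ∀ (r : R) (s : S), (1 : FrobAlg p R) ⊗ₜ[R] (algebraMap R S r * s ^ p) =
      ((show FrobAlg p R from r) ⊗ₜ[R] s) ^ p := fun r s => by
    rw [← Algebra.smul_def, TensorProduct.tmul_smul, TensorProduct.smul_tmul',
      Algebra.TensorProduct.tmul_pow]
    congr 1
    exact mul_one (M := R) _
  have hbij : Function.Bijective Φ := by
    refine frob_factor_bijective (T := FrobAlg p R ⊗[R] S) (S := FrobAlg p S) p g ?_ ?_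
    · intro s
      refine (hΦ 1 s).trans ?_
      change algebraMap R S 1 * _ = _
      rw [map_one, one_mul]; rfl
    · intro t
      have : Nontrivial (FrobAlg p S) := CharP.nontrivial_of_char_ne_one (R := FrobAlg p S) (Fact.out : p.Prime).ne_one
      have : Nontrivial (FrobAlg p R ⊗[R] S) := Φ.toRingHom.domain_nontrivial
      have : CharP (FrobAlg p R ⊗[R] S) p := by
        refine (CharP.charP_iff_prime_eq_zero Fact.out).2 ?_
        have := congrArg (algebraMap (FrobAlg p R) (FrobAlg p R ⊗[R] S))
          (CharP.cast_eq_zero (FrobAlg p R) p)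
        rwa [map_natCast, map_zero] at this
      change g (Φ t) = t ^ p
      induction t with
      | zero => rw [map_zero, map_zero, zero_pow (Fact.out : p.Prime).ne_zero]
      | add x y hx hy => rw [map_add, map_add, hx, hy, add_pow_char]
      | tmul r s =>
        rw [hΦ]
        exact key r s
  refine ⟨(show FrobAlg p S →+ S from AddMonoidHom.id S).comp
    (Φ.toRingHom.toAddMonoidHom.comp (TensorProduct.comm R S (FrobAlg p R)).toAddMonoidHom),
    fun s r => hΦ r s, ?_⟩
  exact hbij.comp (TensorProduct.comm R S (FrobAlg p R)).bijective

theorem relativeFrobenius_bijective_of_etale (R S : Type u) [CommRing R] [CommRing S]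
    [Algebra R S] [Algebra.Etale R S] (p : ℕ) [Fact p.Prime] [CharP R p] [CharP S p] :
    ∃ φ : (S ⊗[R] FrobPush p R) →+ S,
      (∀ (s : S) (r : R),
        φ (s ⊗ₜ[R] (show FrobPush p R from r)) = algebraMap R S r * s ^ p) ∧
      Function.Bijective φ := by
  exact relFrob_core R S p
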